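/- Let (P, L) be a finite projective plane of odd order n. Then every configuration c : P → ZMod 2 with an odd number of lit bulbs can be reduced to exactly 1 lit bulb: there exists a finite set S of lines such that flipping all switches in S transforms c into a configuration with exactly one lit bulb. (Theorem 2.3, odd part) -/

import Mathlib

open scoped Classical

theorem zmod_two_ite (a : ZMod 2) : (if a = 1 then (1 : ZMod 2) else 0) = a := by
  revert a; decide

theorem pair_count {P L : Type*} [Membership P L] [Configuration.ProjectivePlane P L]
    [Fintype P] [Fintype L]
    (hodd : Odd (Configuration.ProjectivePlane.order P L)) (x y : P) :
    ((Finset.univ.filter fun l : L => x ∈ l ∧ y ∈ l).card : ZMod 2) = if x = y then 0 else 1 := by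
  split_ifs with h
  · subst h
    have h1 := Configuration.ProjectivePlane.lineCount_eq L x
    unfold Configuration.lineCount at h1
    rw [Nat.card_eq_fintype_card, Fintype.card_subtype] at h1
    simp only [and_self]
    rw [h1, ZMod.natCast_eq_zero_iff_even]
    exact hodd.add_one
  · obtain ⟨l, hl, hu⟩ := Configuration.HasLines.existsUnique_line P L x y h
    have : (Finset.univ.filter fun l : L => x ∈ l ∧ y ∈ l) = {l} := by
      ext m
      simp only [Finset.mem_filter, Finset.mem_univ, true_and, Finset.mem_singleton]
      exact ⟨fun hm => hu m hm, fun hm => hm ▸ hl⟩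
    rw [this]; simp

theorem even_span {P L : Type*} [Membership P L] [Configuration.ProjectivePlane P L]
    [Fintype P] [Fintype L]
    (hodd : Odd (Configuration.ProjectivePlane.order P L))
    (d : P → ZMod 2) (hd : ∑ y, d y = 0) :
    ∃ S : Finset L, ∀ x : P, ((S.filter fun l : L => x ∈ l).card : ZMod 2) = d x := by
  refine ⟨Finset.univ.filter fun l : L => (∑ y : P, if y ∈ l then d y else 0) = 1, fun x => ?_⟩
  have h2 : ∀ y : P, (∑ l : L, if x ∈ l then (if y ∈ l then d y else 0) else 0)
      = d y - if x = y then d y else 0 := by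
    intro y
    have h3 := pair_count (L := L) hodd x y
    simp only [← ite_and]
    rw [← Finset.sum_filter, Finset.sum_const, nsmul_eq_mul, h3]
    split_ifs <;> simp
  calc _ = ∑ l : L, if x ∈ l then (∑ y : P, if y ∈ l then d y else 0) else 0 := by
        rw [Finset.card_filter, Finset.sum_filter]
        push_cast
        refine Finset.sum_congr rfl fun l _ => ?_
        by_cases hx : x ∈ l
        · simp only [hx, if_true]
          exact zmod_two_ite _
        · simp [hx]
    _ = ∑ l : L, ∑ y : P, if x ∈ l then (if y ∈ l then d y else 0) else 0 := by
        refine Finset.sum_congr rfl fun l _ => ?_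
        split_ifs <;> simp
    _ = ∑ y : P, (d y - if x = y then d y else 0) := by
        rw [Finset.sum_comm]
        exact Finset.sum_congr rfl fun y _ => h2 y
    _ = d x := by
        rw [Finset.sum_sub_distrib, hd]
        simp [ZMod.neg_eq_self_mod_two]

/-- On a finite projective plane of odd order, every configuration with an odd number of
lit bulbs can be reduced, by flipping a finite set of line switches, to a configuration
with exactly one lit bulb. -/
theorem stmt_6 {P L : Type*} [Membership P L] [Configuration.ProjectivePlane P L]
    [Fintype P] [Fintype L]
    (hodd : Odd (Configuration.ProjectivePlane.order P L))
    (c : P → ZMod 2)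
    (hc : Odd (Finset.univ.filter fun x : P => c x = 1).card) :
    ∃ S : Finset L,
      (Finset.univ.filter fun x : P =>
          c x + ((S.filter fun ℓ : L => x ∈ ℓ).card : ZMod 2) = 1).card = 1 := by
  obtain ⟨x0, -⟩ := Finset.card_pos.mp hc.pos
  have hsum : ∑ y, c y = 1 := by
    rw [← ZMod.natCast_eq_one_iff_odd] at hc
    rw [← hc, Finset.card_filter]
    push_cast
    exact Finset.sum_congr rfl fun y _ => (zmod_two_ite _).symm
  obtain ⟨S, hS⟩ := even_span (L := L) hodd (fun y => c y + if y = x0 then 1 else 0) (by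
    rw [Finset.sum_add_distrib, hsum]
    simp
    decide)
  refine ⟨S, ?_⟩
  rw [Finset.card_eq_one]
  refine ⟨x0, ?_⟩
  ext x
  simp only [Finset.mem_filter, Finset.mem_univ, true_and, Finset.mem_singleton, hS]
  rw [← add_assoc, CharTwo.add_self_eq_zero]
  by_cases h : x = x0 <;> simp [h]
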